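/- The direct product of two automatic semigroups is automatic if and only if it is finitely generated. -/

import Mathlib

namespace AutoSg

/-- Evaluation of a nonempty word over alphabet `A` in a semigroup `S`
via the letter-interpretation map `ψ`; the empty word evaluates to `none`. -/
def evalWord {S : Type*} [Semigroup S] {A : Type*} (ψ : A → S) : List A → Option S
  | [] => none
  | a :: w => some ((w.map ψ).foldl (· * ·) (ψ a))

/-- The standard padding map `δ_A` on pairs of words, with `none` playing
the role of the padding symbol `$`. -/
def padMap {A : Type*} (u v : List A) : List (Option A × Option A) :=
  List.zipWith Prod.mk (u.map some ++ List.replicate (v.length - u.length) none)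
    (v.map some ++ List.replicate (u.length - v.length) none)

/-- `(A, L)` is an automatic structure for the semigroup `S` with respect to `ψ`. -/
structure IsAutomaticStructure (S : Type*) [Semigroup S] {A : Type*} [Finite A]
    (ψ : A → S) (L : Language A) : Prop where
  nonempty_words : ∀ w ∈ L, w ≠ []
  regular : L.IsRegular
  onto : ∀ s : S, ∃ w ∈ L, evalWord ψ w = some s
  eq_regular : Language.IsRegular
    {p : List (Option A × Option A) |
      ∃ u ∈ L, ∃ v ∈ L, p = padMap u v ∧ evalWord ψ u = evalWord ψ v}
  mul_regular : ∀ a : A, Language.IsRegular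
    {p : List (Option A × Option A) |
      ∃ u ∈ L, ∃ v ∈ L, p = padMap u v ∧ evalWord ψ (u ++ [a]) = evalWord ψ v}

/-- An automatic structure with uniqueness: each element of `S` is represented
by exactly one word of `L`. -/
structure IsAutomaticStructureWithUniqueness (S : Type*) [Semigroup S] {A : Type*} [Finite A]
    (ψ : A → S) (L : Language A) extends IsAutomaticStructure S ψ L : Prop where
  unique : ∀ u ∈ L, ∀ v ∈ L, evalWord ψ u = evalWord ψ v → u = v

/-- A semigroup is automatic if it admits an automatic structure. -/
def IsAutomaticSemigroup (S : Type*) [Semigroup S] : Prop :=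
  ∃ (A : Type) (_ : Finite A) (ψ : A → S) (L : Language A), IsAutomaticStructure S ψ L


/-- A semigroup is finitely generated if a finite subset generates it. -/
def SemigroupFG (S : Type*) [Semigroup S] : Prop :=
  ∃ U : Finset S, Subsemigroup.closure (U : Set S) = ⊤

end AutoSg

namespace AutoSg

/-! ### Closure properties of regular languages -/

theorem isRegular_of_fold {α σ : Type*} [Finite σ] {K : Language α} (st : List α → σ)
    (step : σ → α → σ) (h_step : ∀ x a, st (x ++ [a]) = step (st x) a) (acc : Set σ)
    (h_acc : ∀ w, w ∈ K ↔ st w ∈ acc) : K.IsRegular := by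
  have := Fintype.ofFinite σ
  refine Language.isRegular_iff.2 ⟨σ, this, ⟨step, st [], acc⟩, ?_⟩
  have key : ∀ w, (DFA.mk step (st []) acc).eval w = st w := by
    intro w
    induction w using List.reverseRecOn with
    | nil => rfl
    | append_singleton x a ih => rw [DFA.eval_append_singleton, ih, h_step]
  ext w
  rw [DFA.mem_accepts, key, h_acc]

theorem IsRegular.of_mem_iff {α : Type*} {K K' : Set (List α)} (h : Language.IsRegular K)
    (e : ∀ w, w ∈ K' ↔ w ∈ K) : Language.IsRegular K' := by
  rwa [Set.ext e]

theorem IsRegular.univ {α : Type*} : Language.IsRegular (Set.univ : Set (List α)) :=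
  isRegular_of_fold (fun _ => ()) (fun _ _ => ()) (fun _ _ => rfl) Set.univ
    (fun _ => ⟨fun _ => trivial, fun _ => trivial⟩)

theorem IsRegular.inter {α : Type*} {K K' : Set (List α)} (h : Language.IsRegular K)
    (h' : Language.IsRegular K') : Language.IsRegular {w | w ∈ K ∧ w ∈ K'} :=
  Language.IsRegular.inf h h'

theorem IsRegular.preimage {α β : Type*} (f : α → β) {K : Set (List β)}
    (h : Language.IsRegular K) : Language.IsRegular {w | w.map f ∈ K} := by
  obtain ⟨σ, hσ, M, rfl⟩ := h
  exact ⟨σ, hσ, M.comap f, DFA.accepts_comap M f⟩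

theorem IsRegular.image {α β : Type*} (f : α → β) {K : Set (List α)}
    (h : Language.IsRegular K) : Language.IsRegular (List.map f '' K) := by
  obtain ⟨σ, hσ, M, rfl⟩ := h
  refine isRegular_of_fold (fun w => {s | ∃ v, v.map f = w ∧ M.eval v = s})
    (fun S b => {s' | ∃ s ∈ S, ∃ a, f a = b ∧ M.step s a = s'}) ?_
    {S | ∃ s ∈ S, s ∈ M.accept} ?_
  · intro x b
    ext s'
    constructor
    · rintro ⟨v, hv, rfl⟩
      obtain ⟨v₁, v₂, rfl, h₁, h₂⟩ := List.map_eq_append_iff.1 hv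
      obtain ⟨a, rfl, ha⟩ := List.map_eq_singleton_iff.1 h₂
      exact ⟨_, ⟨v₁, h₁, rfl⟩, a, ha, by simp⟩
    · rintro ⟨_, ⟨v, rfl, rfl⟩, a, rfl, rfl⟩
      exact ⟨v ++ [a], by simp, by simp⟩
  · intro w
    constructor
    · rintro ⟨v, hv, rfl⟩
      exact ⟨_, ⟨v, rfl, rfl⟩, hv⟩
    · rintro ⟨_, ⟨v, rfl, rfl⟩, hv⟩
      exact ⟨v, hv, rfl⟩

theorem IsRegular.iUnion {α ι : Type*} [Finite ι] {K : ι → Set (List α)}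
    (h : ∀ i, Language.IsRegular (K i)) : Language.IsRegular {w | ∃ i, w ∈ K i} := by
  choose σ hσ M hM using h
  refine isRegular_of_fold (fun w i => (M i).eval w) (fun s a i => (M i).step (s i) a)
    (by intros; ext i; simp) {s | ∃ i, s i ∈ (M i).accept} ?_
  intro w
  refine exists_congr fun i => ?_
  rw [← DFA.mem_accepts, hM]
  rfl

theorem IsRegular.append_replicate {α : Type*} (z : α) {K : Set (List α)}
    (h : Language.IsRegular K) :
    Language.IsRegular {w | ∃ k, ∃ x ∈ K, w = x ++ List.replicate k z} := by
  classical
  obtain ⟨σ, hσ, M, rfl⟩ := h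
  refine isRegular_of_fold
    (fun w => (M.eval w, (∃ k, ∃ x ∈ M.accepts, w = x ++ List.replicate k z : Prop)))
    (fun s a => (M.step s.1 a, (a = z ∧ s.2) ∨ M.step s.1 a ∈ M.accept)) ?_ {s | s.2}
    (fun w => Iff.rfl)
  intro x a
  refine Prod.ext (by simp) (propext ⟨?_, ?_⟩)
  · rintro ⟨k, y, hy, e⟩
    cases k with
    | zero =>
      right
      rw [← M.eval_append_singleton, e]
      simpa [DFA.mem_accepts] using hy
    | succ k =>
      left
      rw [List.replicate_succ', ← List.append_assoc] at e
      obtain ⟨e₁, e₂⟩ := List.append_inj' e rfl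
      exact ⟨by simpa using e₂, k, y, hy, e₁⟩
  · rintro (⟨rfl, k, y, hy, e⟩ | h)
    · exact ⟨k + 1, y, hy, by rw [e, List.replicate_succ', List.append_assoc]⟩
    · exact ⟨0, x ++ [a], by simpa [DFA.mem_accepts] using h, by simp⟩

theorem IsRegular.quotient_replicate {α : Type*} (z : α) {K : Set (List α)}
    (h : Language.IsRegular K) :
    Language.IsRegular {w | ∃ k, w ++ List.replicate k z ∈ K} := by
  obtain ⟨σ, hσ, M, rfl⟩ := h
  refine isRegular_of_fold M.eval M.step (by simp)
    {s | ∃ k, M.evalFrom s (List.replicate k z) ∈ M.accept} ?_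
  intro w
  refine exists_congr fun k => ?_
  refine (DFA.mem_accepts M).trans ?_
  rw [DFA.eval, DFA.evalFrom_of_append]

theorem isRegular_notMem {α : Type*} (z : α) :
    Language.IsRegular {w : List α | z ∉ w} := by
  refine isRegular_of_fold (fun w => z ∉ w) (fun s a => s ∧ z ≠ a) ?_ {s | s} (fun _ => Iff.rfl)
  intro x a
  simp [not_or]

/-! ### Padded words and regular relations -/

/-- `Pads w u` says that `w` is the word `u` followed by padding symbols. -/
def Pads {A : Type*} (w : List (Option A)) (u : List A) : Prop :=
  ∃ k, w = u.map some ++ List.replicate k none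

theorem Pads.reduceOption {A : Type*} {w : List (Option A)} {u : List A} (h : Pads w u) :
    w.reduceOption = u := by
  obtain ⟨k, rfl⟩ := h
  rw [List.reduceOption_append, List.reduceOption_replicate_none, List.append_nil]
  simp [List.reduceOption, List.filterMap_map]

theorem Pads.unique {A : Type*} {w : List (Option A)} {u v : List A} (h : Pads w u)
    (h' : Pads w v) : u = v :=
  h.reduceOption.symm.trans h'.reduceOption

theorem pads_map_some {A : Type*} (u : List A) : Pads (u.map some) u := ⟨0, by simp⟩

theorem pads_append_replicate {A : Type*} {w : List (Option A)} {u : List A} (k : ℕ) :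
    Pads (w ++ List.replicate k none) u ↔ Pads w u := by
  induction k with
  | zero => simp
  | succ k ih =>
    rw [← ih, List.replicate_succ', ← List.append_assoc]
    constructor
    · rintro ⟨j, e⟩
      cases j with
      | zero =>
        have : none ∈ u.map some := by
          rw [List.replicate_zero, List.append_nil] at e
          rw [← e]; simp
        simp at this
      | succ j =>
        rw [List.replicate_succ', ← List.append_assoc] at e
        exact ⟨j, (List.append_inj' e rfl).1⟩
    · rintro ⟨j, e⟩
      exact ⟨j + 1, by rw [e, List.replicate_succ', List.append_assoc]⟩

theorem isRegular_pads {A : Type*} {L : Set (List A)} (h : Language.IsRegular L) :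
    Language.IsRegular {w | ∃ u ∈ L, Pads w u} := by
  refine IsRegular.of_mem_iff (IsRegular.append_replicate none (IsRegular.image some h))
    fun w => ?_
  constructor
  · rintro ⟨u, hu, k, rfl⟩
    exact ⟨k, _, ⟨u, hu, rfl⟩, rfl⟩
  · rintro ⟨k, _, ⟨u, hu, rfl⟩, rfl⟩
    exact ⟨u, hu, k, rfl⟩

/-- The language of all padded encodings of the pairs in a relation between words. -/
def padLang {A B : Type*} (R : List A → List B → Prop) : Set (List (Option A × Option B)) :=
  {p | ∃ u v, R u v ∧ Pads (p.map Prod.fst) u ∧ Pads (p.map Prod.snd) v}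

/-- A relation between words is regular if the language of its padded encodings is. -/
def RegRel {A B : Type*} (R : List A → List B → Prop) : Prop :=
  Language.IsRegular (padLang R)

theorem map_pair_ext {α β : Type*} {p q : List (α × β)} (h₁ : p.map Prod.fst = q.map Prod.fst)
    (h₂ : p.map Prod.snd = q.map Prod.snd) : p = q := by
  rw [← List.zip_unzip p, ← List.zip_unzip q]
  simp only [List.unzip_fst, List.unzip_snd, h₁, h₂]

theorem map_fst_padMap {A : Type*} (u v : List A) :
    (padMap u v).map Prod.fst = u.map some ++ List.replicate (v.length - u.length) none :=
  List.map_fst_zip (by simp; omega)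

theorem map_snd_padMap {A : Type*} (u v : List A) :
    (padMap u v).map Prod.snd = v.map some ++ List.replicate (u.length - v.length) none :=
  List.map_snd_zip (by simp; omega)

theorem none_none_notMem_padMap {A : Type*} (u v : List A) : (none, none) ∉ padMap u v := by
  induction u generalizing v with
  | nil =>
    intro h
    have := List.mem_map_of_mem (f := Prod.snd) h
    rw [map_snd_padMap] at this
    simp at this
  | cons a u ih =>
    cases v with
    | nil =>
      intro h
      have := List.mem_map_of_mem (f := Prod.fst) h
      rw [map_fst_padMap] at this
      simp at this
    | cons b v =>
      have : padMap (a :: u) (b :: v) = (some a, some b) :: padMap u v := by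
        simp [padMap]
      rw [this]
      simpa using ih v

theorem pads_iff_padMap {A : Type*} {p : List (Option A × Option A)} {u v : List A} :
    Pads (p.map Prod.fst) u ∧ Pads (p.map Prod.snd) v ↔
      ∃ k, p = padMap u v ++ List.replicate k (none, none) := by
  constructor
  · rintro ⟨⟨i, hi⟩, ⟨j, hj⟩⟩
    have li := congrArg List.length hi
    have lj := congrArg List.length hj
    simp only [List.length_map, List.length_append, List.length_replicate] at li lj
    refine ⟨p.length - max u.length v.length, map_pair_ext ?_ ?_⟩
    · rw [List.map_append, map_fst_padMap, hi, List.map_replicate, List.append_assoc,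
        List.replicate_append_replicate]
      congr 2
      omega
    · rw [List.map_append, map_snd_padMap, hj, List.map_replicate, List.append_assoc,
        List.replicate_append_replicate]
      congr 2
      omega
  · rintro ⟨k, rfl⟩
    rw [List.map_append, List.map_append, map_fst_padMap, map_snd_padMap, List.map_replicate,
      List.map_replicate]
    exact ⟨(pads_append_replicate k).2 ⟨_, rfl⟩, (pads_append_replicate k).2 ⟨_, rfl⟩⟩

theorem regRel_iff_padMap {A : Type*} {R : List A → List A → Prop} :
    RegRel R ↔ Language.IsRegular {p | ∃ u v, R u v ∧ p = padMap u v} := by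
  constructor
  · intro h
    refine IsRegular.of_mem_iff (IsRegular.inter h (isRegular_notMem (none, none))) fun p => ?_
    constructor
    · rintro ⟨u, v, hR, rfl⟩
      exact ⟨⟨u, v, hR, pads_iff_padMap.2 ⟨0, by simp⟩⟩, none_none_notMem_padMap u v⟩
    · rintro ⟨⟨u, v, hR, hp⟩, hn⟩
      obtain ⟨k, rfl⟩ := pads_iff_padMap.1 hp
      cases k with
      | zero => exact ⟨u, v, hR, by simp⟩
      | succ k => exact absurd (by simp) hn
  · intro h
    refine IsRegular.of_mem_iff (IsRegular.append_replicate (none, none) h)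
      fun p => Iff.symm ?_
    constructor
    · rintro ⟨k, _, ⟨u, v, hR, rfl⟩, rfl⟩
      exact ⟨u, v, hR, pads_iff_padMap.2 ⟨k, rfl⟩⟩
    · rintro ⟨u, v, hR, hp⟩
      obtain ⟨k, rfl⟩ := pads_iff_padMap.1 hp
      exact ⟨k, _, ⟨u, v, hR, rfl⟩, rfl⟩

theorem RegRel.congr {A B : Type*} {R R' : List A → List B → Prop} (h : RegRel R)
    (e : ∀ u v, R' u v ↔ R u v) : RegRel R' := by
  have : R' = R := by ext u v; exact e u v
  rwa [this]

theorem RegRel.and {A B : Type*} {R R' : List A → List B → Prop} (h : RegRel R)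
    (h' : RegRel R') : RegRel (fun u v => R u v ∧ R' u v) := by
  refine IsRegular.of_mem_iff (IsRegular.inter h h') fun p => Iff.symm ?_
  constructor
  · rintro ⟨⟨u, v, hR, hu, hv⟩, ⟨u', v', hR', hu', hv'⟩⟩
    obtain rfl := hu.unique hu'
    obtain rfl := hv.unique hv'
    exact ⟨u, v, ⟨hR, hR'⟩, hu, hv⟩
  · rintro ⟨u, v, ⟨hR, hR'⟩, hu, hv⟩
    exact ⟨⟨u, v, hR, hu, hv⟩, ⟨u, v, hR', hu, hv⟩⟩

theorem RegRel.iUnion {A B ι : Type*} [Finite ι] {R : ι → List A → List B → Prop}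
    (h : ∀ i, RegRel (R i)) : RegRel (fun u v => ∃ i, R i u v) := by
  refine IsRegular.of_mem_iff
    (IsRegular.iUnion h) fun p => Iff.symm ?_
  constructor
  · rintro ⟨i, u, v, hR, h⟩
    exact ⟨u, v, ⟨i, hR⟩, h⟩
  · rintro ⟨u, v, ⟨i, hR⟩, h⟩
    exact ⟨i, u, v, hR, h⟩

theorem RegRel.prod {A B : Type*} {K : Set (List A)} {K' : Set (List B)}
    (h : Language.IsRegular K) (h' : Language.IsRegular K') :
    RegRel (fun u v => u ∈ K ∧ v ∈ K') := by
  refine IsRegular.of_mem_iff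
    (IsRegular.inter (IsRegular.preimage Prod.fst (isRegular_pads h))
      (IsRegular.preimage Prod.snd (isRegular_pads h'))) fun p => Iff.symm ?_
  constructor
  · rintro ⟨⟨u, hu, hpu⟩, ⟨v, hv, hpv⟩⟩
    exact ⟨u, v, ⟨hu, hv⟩, hpu, hpv⟩
  · rintro ⟨u, v, ⟨hu, hv⟩, hpu, hpv⟩
    exact ⟨⟨u, hu, hpu⟩, ⟨v, hv, hpv⟩⟩

theorem RegRel.comp {A B C : Type*} {R : List A → List B → Prop} {R' : List B → List C → Prop}
    (h : RegRel R) (h' : RegRel R') : RegRel (fun u v => ∃ z, R u z ∧ R' z v) := by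
  refine IsRegular.of_mem_iff
    (IsRegular.quotient_replicate (none, none)
      (IsRegular.image (fun t : Option A × Option B × Option C => (t.1, t.2.2))
        (IsRegular.inter (IsRegular.preimage (fun t => (t.1, t.2.1)) h)
          (IsRegular.preimage (fun t => t.2) h')))) fun p => Iff.symm ?_
  constructor
  · rintro ⟨k, t, ⟨⟨u, z, hR, hu, hz⟩, ⟨z', v, hR', hz', hv⟩⟩, e⟩
    simp only [List.map_map] at hu hz hz' hv
    obtain rfl := hz.unique hz'
    have e₁ := congrArg (List.map Prod.fst) e
    have e₂ := congrArg (List.map Prod.snd) e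
    simp only [List.map_map, List.map_append, List.map_replicate] at e₁ e₂
    refine ⟨u, v, ⟨z, hR, hR'⟩, ?_, ?_⟩
    · rw [← pads_append_replicate k, ← e₁]
      exact hu
    · rw [← pads_append_replicate k, ← e₂]
      exact hv
  · rintro ⟨u, v, ⟨z, hR, hR'⟩, hu, hv⟩
    have len : (p ++ List.replicate z.length (none, none)).length =
        (z.map some ++ List.replicate p.length none).length := by
      simp [add_comm]
    have e₁ := List.map_fst_zip len.le
    have e₂ := List.map_snd_zip len.ge
    have hu' : Pads ((p ++ List.replicate z.length (none, none)).map Prod.fst) u := by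
      rwa [List.map_append, List.map_replicate, pads_append_replicate]
    have hv' : Pads ((p ++ List.replicate z.length (none, none)).map Prod.snd) v := by
      rwa [List.map_append, List.map_replicate, pads_append_replicate]
    rw [← e₁, List.map_map] at hu' hv'
    have hz' : Pads (z.map some ++ List.replicate p.length none) z := ⟨_, rfl⟩
    rw [← e₂] at hz'
    refine ⟨z.length, (List.zip (p ++ List.replicate z.length (none, none))
      (z.map some ++ List.replicate p.length none)).map (fun x => (x.1.1, x.2, x.1.2)),
      ⟨⟨u, z, hR, ?_, ?_⟩, ⟨z, v, hR', ?_, ?_⟩⟩, ?_⟩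
    · rw [List.map_map, List.map_map]
      exact hu'
    · rw [List.map_map, List.map_map]
      exact hz'
    · rw [List.map_map, List.map_map]
      exact hz'
    · rw [List.map_map, List.map_map]
      exact hv'
    · rw [List.map_map]
      exact e₁

theorem Pads.map_bind_iff {A C : Type*} (d : C → Option A) {q : List (Option C)} {w : List C}
    {u : List A} (h : Pads q w) : Pads (q.map (fun o => o.bind d)) u ↔ Pads (w.map d) u := by
  obtain ⟨k, rfl⟩ := h
  rw [List.map_append, List.map_replicate, List.map_map]
  exact pads_append_replicate k

theorem RegRel.substitution {A B C D : Type*} {R : List A → List B → Prop} (h : RegRel R)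
    (d : C → Option A) (e : D → Option B) {E : Set (List C)} {E' : Set (List D)}
    (hE : Language.IsRegular E) (hE' : Language.IsRegular E') :
    RegRel (fun w w' => (w ∈ E ∧ w' ∈ E') ∧
      ∃ u v, R u v ∧ Pads (w.map d) u ∧ Pads (w'.map e) v) := by
  have fst_eq : ∀ p : List (Option C × Option D),
      (p.map (fun t => (t.1.bind d, t.2.bind e))).map Prod.fst =
        (p.map Prod.fst).map (fun o => o.bind d) := by
    intro p; simp only [List.map_map]; rfl
  have snd_eq : ∀ p : List (Option C × Option D),
      (p.map (fun t => (t.1.bind d, t.2.bind e))).map Prod.snd =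
        (p.map Prod.snd).map (fun o => o.bind e) := by
    intro p; simp only [List.map_map]; rfl
  refine IsRegular.of_mem_iff (IsRegular.inter (RegRel.prod hE hE')
    (IsRegular.preimage (fun t : Option C × Option D => (t.1.bind d, t.2.bind e)) h))
    fun p => Iff.symm ?_
  constructor
  · rintro ⟨⟨w, w', hw, hpw, hpw'⟩, ⟨u, v, hR, hu, hv⟩⟩
    rw [fst_eq, hpw.map_bind_iff] at hu
    rw [snd_eq, hpw'.map_bind_iff] at hv
    exact ⟨w, w', ⟨hw, u, v, hR, hu, hv⟩, hpw, hpw'⟩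
  · rintro ⟨w, w', ⟨hw, u, v, hR, hu, hv⟩, hpw, hpw'⟩
    refine ⟨⟨w, w', hw, hpw, hpw'⟩, ⟨u, v, hR, ?_, ?_⟩⟩
    · rwa [fst_eq, hpw.map_bind_iff]
    · rwa [snd_eq, hpw'.map_bind_iff]

theorem pads_map_some_comp {A C : Type*} (f : C → A) (w : List C) :
    Pads (w.map (fun c => some (f c))) (w.map f) :=
  ⟨0, by simp⟩

theorem RegRel.comap {A B C D : Type*} {R : List A → List B → Prop} (h : RegRel R)
    (f : C → A) (g : D → B) : RegRel (fun w w' => R (w.map f) (w'.map g)) := by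
  refine (h.substitution (fun c => some (f c)) (fun c => some (g c)) IsRegular.univ
    IsRegular.univ).congr fun w w' => ?_
  constructor
  · intro hR
    exact ⟨⟨trivial, trivial⟩, _, _, hR, pads_map_some_comp f w, pads_map_some_comp g w'⟩
  · rintro ⟨-, u, v, hR, hu, hv⟩
    rwa [(pads_map_some_comp f w).unique hu, (pads_map_some_comp g w').unique hv]

/-! ### Evaluation in the monoid obtained by adjoining an identity -/

section Eval

variable {S T : Type*} [Semigroup S] [Semigroup T] {A : Type*}

/-- The value of a word in `S` with an identity adjoined. -/
def ev (ψ : A → S) (u : List A) : WithOne S := (u.map fun a => (ψ a : WithOne S)).prod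

@[simp] theorem ev_nil (ψ : A → S) : ev ψ [] = 1 := rfl

@[simp] theorem ev_cons (ψ : A → S) (a : A) (u : List A) : ev ψ (a :: u) = ψ a * ev ψ u := by
  simp [ev]

@[simp] theorem ev_append (ψ : A → S) (u v : List A) : ev ψ (u ++ v) = ev ψ u * ev ψ v := by
  simp [ev]

theorem ev_ne_one (ψ : A → S) {u : List A} (h : u ≠ []) : ev ψ u ≠ 1 := by
  cases u with
  | nil => exact absurd rfl h
  | cons a u =>
    rw [ev_cons]
    induction ev ψ u with
    | one => rw [mul_one]; exact WithOne.coe_ne_one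
    | coe t => rw [← WithOne.coe_mul]; exact WithOne.coe_ne_one

theorem evalWord_eq_ev (ψ : A → S) (u : List A) :
    (show WithOne S from evalWord ψ u) = ev ψ u := by
  cases u with
  | nil => rfl
  | cons a u =>
    have key : ∀ (u : List A) (x : S),
        (((u.map ψ).foldl (· * ·) x : S) : WithOne S) = x * ev ψ u := by
      intro u
      induction u with
      | nil => intro x; simp
      | cons b u ih =>
        intro x
        rw [List.map_cons, List.foldl_cons, ih, WithOne.coe_mul, ev_cons, mul_assoc]
    rw [ev_cons]
    exact key u (ψ a)

theorem evalWord_eq_iff {ψ : A → S} {u v : List A} :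
    evalWord ψ u = evalWord ψ v ↔ ev ψ u = ev ψ v := by
  rw [← evalWord_eq_ev, ← evalWord_eq_ev]
  rfl

theorem evalWord_eq_some_iff {ψ : A → S} {u : List A} {s : S} :
    evalWord ψ u = some s ↔ ev ψ u = s := by
  rw [← evalWord_eq_ev]
  rfl

theorem isAutomaticStructure_iff [Finite A] {ψ : A → S} {L : Set (List A)} :
    IsAutomaticStructure S ψ L ↔ (∀ w ∈ L, w ≠ []) ∧ Language.IsRegular L ∧
      (∀ s : S, ∃ w ∈ L, ev ψ w = s) ∧
      RegRel (fun u v => (u ∈ L ∧ v ∈ L) ∧ ev ψ u = ev ψ v) ∧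
      ∀ a, RegRel (fun u v => (u ∈ L ∧ v ∈ L) ∧ ev ψ u * ψ a = ev ψ v) := by
  have h_eq : {p | ∃ u v, ((u ∈ L ∧ v ∈ L) ∧ ev ψ u = ev ψ v) ∧ p = padMap u v} =
      {p : List (Option A × Option A) |
        ∃ u ∈ L, ∃ v ∈ L, p = padMap u v ∧ evalWord ψ u = evalWord ψ v} := by
    ext p
    simp only [evalWord_eq_iff, Set.mem_ofPred_eq]
    grind
  have h_mul : ∀ a, {p | ∃ u v, ((u ∈ L ∧ v ∈ L) ∧ ev ψ u * ψ a = ev ψ v) ∧ p = padMap u v} =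
      {p : List (Option A × Option A) |
        ∃ u ∈ L, ∃ v ∈ L, p = padMap u v ∧ evalWord ψ (u ++ [a]) = evalWord ψ v} := by
    intro a
    ext p
    simp only [evalWord_eq_iff, Set.mem_ofPred_eq, ev_append, ev_cons, ev_nil, mul_one]
    grind
  simp only [regRel_iff_padMap, h_eq, h_mul]
  constructor
  · rintro ⟨h₁, h₂, h₃, h₄, h₅⟩
    exact ⟨h₁, h₂, fun s => (h₃ s).imp fun w h => ⟨h.1, evalWord_eq_some_iff.1 h.2⟩, h₄, h₅⟩
  · rintro ⟨h₁, h₂, h₃, h₄, h₅⟩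
    exact ⟨h₁, h₂, fun s => (h₃ s).imp fun w h => ⟨h.1, evalWord_eq_some_iff.2 h.2⟩, h₄, h₅⟩

theorem IsAutomaticStructure.regRel_mul [Finite A] {ψ : A → S} {L : Set (List A)}
    (h : IsAutomaticStructure S ψ L) (s : S) :
    RegRel (fun u v => (u ∈ L ∧ v ∈ L) ∧ ev ψ u * s = ev ψ v) := by
  obtain ⟨h_ne, -, h_onto, h_eq, h_mul⟩ := isAutomaticStructure_iff.1 h
  obtain ⟨x, -, hx⟩ := h_onto s
  rw [← hx]
  clear hx
  induction x using List.reverseRecOn with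
  | nil => simpa using h_eq
  | append_singleton x a ih =>
    refine (ih.comp (h_mul a)).congr fun u v => ?_
    constructor
    · rintro ⟨⟨hu, hv⟩, e⟩
      have hne : ev ψ u * ev ψ x ≠ 1 := by
        rw [← ev_append]
        exact ev_ne_one ψ (by simp [h_ne u hu])
      obtain ⟨t, ht⟩ := WithOne.ne_one_iff_exists.1 hne
      obtain ⟨z, hz, hzt⟩ := h_onto t
      refine ⟨z, ⟨⟨hu, hz⟩, by rw [hzt, ht]⟩, ⟨hz, hv⟩, ?_⟩
      rw [hzt, ht, ← e, ev_append, ev_cons, ev_nil, mul_one, mul_assoc]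
    · rintro ⟨z, ⟨⟨hu, hz⟩, e⟩, ⟨-, hv⟩, e'⟩
      refine ⟨⟨hu, hv⟩, ?_⟩
      rw [← e', ← e, ev_append, ev_cons, ev_nil, mul_one, mul_assoc]

theorem mem_closure_range_of_ev {ψ : A → S} (w : List A) :
    ∀ s : S, ev ψ w = s → s ∈ Subsemigroup.closure (Set.range ψ) := by
  induction w with
  | nil => intro s h; exact absurd h WithOne.one_ne_coe
  | cons a w ih =>
    intro s h
    have ha : ψ a ∈ Subsemigroup.closure (Set.range ψ) :=
      Subsemigroup.subset_closure ⟨a, rfl⟩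
    rw [ev_cons] at h
    by_cases h1 : ev ψ w = 1
    · rw [h1, mul_one] at h
      rwa [← WithOne.coe_inj.1 h]
    · obtain ⟨t, ht⟩ := WithOne.ne_one_iff_exists.1 h1
      rw [← ht, ← WithOne.coe_mul] at h
      rw [← WithOne.coe_inj.1 h]
      exact mul_mem ha (ih t ht.symm)

theorem IsAutomaticSemigroup.semigroupFG (h : IsAutomaticSemigroup S) : SemigroupFG S := by
  obtain ⟨A, hA, ψ, L, hL⟩ := h
  obtain ⟨-, -, h_onto, -⟩ := isAutomaticStructure_iff.1 hL
  refine ⟨(Set.finite_range ψ).toFinset, eq_top_iff.2 fun s _ => ?_⟩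
  obtain ⟨w, -, hw⟩ := h_onto s
  rw [Set.Finite.coe_toFinset]
  exact mem_closure_range_of_ev w s hw

/-! ### Finite semigroups -/

theorem isAutomaticStructure_of_finite [Finite A] [Finite S] {ψ : A → S}
    (hψ : Function.Surjective ψ) : IsAutomaticStructure S ψ {w | w ≠ []} := by
  have : Finite (WithOne S) := inferInstanceAs (Finite (Option S))
  have reg : ∀ q : WithOne S, Language.IsRegular {w : List A | w ≠ [] ∧ ev ψ w = q} := by
    intro q
    refine isRegular_of_fold (ev ψ) (fun s a => s * ψ a) (by simp) {s | s ≠ 1 ∧ s = q} ?_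
    intro w
    refine and_congr_left' ⟨ev_ne_one ψ, ?_⟩
    rintro h rfl
    exact h rfl
  refine isAutomaticStructure_iff.2 ⟨fun w hw => hw, ?_, ?_, ?_, ?_⟩
  · refine IsRegular.of_mem_iff (IsRegular.iUnion reg) fun w => Iff.symm ?_
    simp
  · intro s
    obtain ⟨a, rfl⟩ := hψ s
    exact ⟨[a], by simp, by simp⟩
  · refine (RegRel.iUnion fun q => RegRel.prod (reg q) (reg q)).congr fun u v => ?_
    simp only [Set.mem_ofPred_eq]
    grind
  · intro a
    refine (RegRel.iUnion fun q => RegRel.prod (reg q) (reg (q * ψ a))).congr fun u v => ?_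
    simp only [Set.mem_ofPred_eq]
    grind

theorem isAutomaticSemigroup_of_finite [Finite S] : IsAutomaticSemigroup S := by
  obtain ⟨n, ⟨e⟩⟩ := Finite.exists_equiv_fin S
  exact ⟨Fin n, inferInstance, e.symm, _, isAutomaticStructure_of_finite e.symm.surjective⟩

theorem exists_word_of_length (hS : ∀ s : S, ∃ x y, s = x * y) {ψ : A → S}
    (hψ : Function.Surjective ψ) (n : ℕ) : ∀ s : S, ∃ w, w.length = n + 1 ∧ ev ψ w = s := by
  induction n with
  | zero =>
    intro s
    obtain ⟨a, rfl⟩ := hψ s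
    exact ⟨[a], by simp, by simp⟩
  | succ n ih =>
    intro s
    obtain ⟨x, y, rfl⟩ := hS s
    obtain ⟨a, rfl⟩ := hψ x
    obtain ⟨w, hw, e⟩ := ih y
    exact ⟨a :: w, by simp [hw], by simp [e]⟩

/-! ### Lengthening representatives -/

/-- Letters of the lengthened words: `(b, x, more)` starts the expansion of the letter `x` if `b`
holds and continues a running expansion otherwise; the expansion goes on after it iff `more`. -/
abbrev ExpLetter (A : Type*) := Bool × A × Bool

/-- The original letter whose expansion starts here, if any. -/
def ExpLetter.decode (c : ExpLetter A) : Option A := if c.1 then some c.2.1 else none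

/-- The value of a letter, where `F x` is the left factor in `ψ x = F x * ψ (g x)`. -/
def ExpLetter.value (ψ F : A → S) (c : ExpLetter A) : S := if c.2.2 then F c.2.1 else ψ c.2.1

open Classical in
/-- Transitions of the automaton verifying expansions: the state `none` is a failure, and
`some p` records the letter `p` still to be expanded. -/
noncomputable def expStep (g : A → A) (s : Option (Option A)) (c : ExpLetter A) :
    Option (Option A) :=
  s.bind fun p =>
    if (p = none ∧ c.1 = true) ∨ (p = some c.2.1 ∧ c.1 = false) then
      some (if c.2.2 then some (g c.2.1) else none)
    else none

/-- The lengthened words representing words of `L`. -/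
def expLang (g : A → A) (L : Set (List A)) : Set (List (ExpLetter A)) :=
  {w | w.foldl (expStep g) (some none) = some none} ∩
    {w | w.map ExpLetter.decode ∈ {q | ∃ u ∈ L, Pads q u}}

theorem isRegular_expLang [Finite A] (g : A → A) {L : Set (List A)}
    (h : Language.IsRegular L) : Language.IsRegular (expLang g L) := by
  refine IsRegular.inter ?_ (IsRegular.preimage _ (isRegular_pads h))
  exact isRegular_of_fold (fun w => w.foldl (expStep g) (some none)) (expStep g) (by simp)
    {some none} (fun w => Iff.rfl)

theorem ev_value_mul {ψ F : A → S} {g : A → A} (hF : ∀ a, ψ a = F a * ψ (g a))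
    (w : List (ExpLetter A)) : ∀ p, w.foldl (expStep g) (some none) = some p →
      ev (ExpLetter.value ψ F) w * ev ψ p.toList =
        ev ψ (w.map ExpLetter.decode).reduceOption := by
  induction w using List.reverseRecOn with
  | nil =>
    intro p h
    obtain rfl : none = p := by simpa using h
    simp
  | append_singleton w c ih =>
    intro p h
    rw [List.foldl_append, List.foldl_cons, List.foldl_nil] at h
    obtain ⟨q, hq, h⟩ := Option.bind_eq_some_iff.1 h
    have ih := ih q hq
    obtain ⟨b, x, m⟩ := c
    have hx : ((ExpLetter.value ψ F (b, x, m) : S) : WithOne S) * ev ψ p.toList = ψ x := by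
      split_ifs at h with h1 h2
      · obtain rfl : some (g x) = p := by simpa using h
        simp only at h2
        simp [ExpLetter.value, h2, ← WithOne.coe_mul, ← hF]
      · obtain rfl : none = p := by simpa using h
        simp only at h2
        simp [ExpLetter.value, h2]
    rw [ev_append, mul_assoc, ev_cons, ev_nil, mul_one, hx, List.map_append,
      List.reduceOption_append, ev_append, ← ih]
    split_ifs at h with h1 <;> rcases h1 with ⟨rfl, hb⟩ | ⟨rfl, hb⟩ <;>
      · simp only at hb
        subst hb
        simp [ExpLetter.decode]

theorem ev_of_mem_expLang {ψ F : A → S} {g : A → A} (hF : ∀ a, ψ a = F a * ψ (g a))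
    {w : List (ExpLetter A)} (h : w.foldl (expStep g) (some none) = some none) {u : List A}
    (hu : Pads (w.map ExpLetter.decode) u) : ev (ExpLetter.value ψ F) w = ev ψ u := by
  simpa [hu.reduceOption] using ev_value_mul hF w none h

theorem exists_expansion (g : A → A) (m : ℕ) : ∀ x : A, ∃ w : List (ExpLetter A),
    w.length = m + 1 ∧ w.foldl (expStep g) (some (some x)) = some none ∧
      w.map ExpLetter.decode = List.replicate (m + 1) none := by
  induction m with
  | zero =>
    intro x
    exact ⟨[(false, x, false)], by simp, by simp [expStep], by simp [ExpLetter.decode]⟩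
  | succ m ih =>
    intro x
    obtain ⟨w, h₁, h₂, h₃⟩ := ih (g x)
    refine ⟨(false, x, true) :: w, by simp [h₁], ?_, ?_⟩
    · simpa [expStep] using h₂
    · rw [List.replicate_succ, List.map_cons, h₃]
      simp [ExpLetter.decode]

theorem foldl_expStep_plain (g : A → A) (u : List A) :
    (u.map fun a => ((true, a, false) : ExpLetter A)).foldl (expStep g) (some none) =
      some none := by
  induction u with
  | nil => rfl
  | cons a u ih => simpa [expStep] using ih

theorem exists_mem_expLang (g : A → A) {L : Set (List A)} {u : List A} (hu : u ∈ L)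
    (hne : u ≠ []) {n : ℕ} (hn : u.length + 1 ≤ n) :
    ∃ w ∈ expLang g L, w.length = n ∧ Pads (w.map ExpLetter.decode) u := by
  obtain ⟨m, rfl⟩ := Nat.exists_eq_add_of_le hn
  obtain ⟨u, a, rfl⟩ := List.eq_nil_or_concat' u |>.resolve_left hne
  obtain ⟨w, h₁, h₂, h₃⟩ := exists_expansion g m (g a)
  have hp : Pads (((u.map fun a => ((true, a, false) : ExpLetter A)) ++
      (true, a, true) :: w).map ExpLetter.decode) (u ++ [a]) := by
    refine ⟨m + 1, ?_⟩
    rw [List.map_append, List.map_cons, h₃]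
    simp [ExpLetter.decode]
  refine ⟨_, ⟨?_, _, hu, hp⟩, ?_, hp⟩
  · rw [Set.mem_ofPred_eq, List.foldl_append, foldl_expStep_plain, List.foldl_cons]
    simpa [expStep] using h₂
  · simp [h₁]
    omega

theorem IsAutomaticStructure.expLang [Finite A] {ψ F : A → S} {g : A → A} {L : Set (List A)}
    (h : IsAutomaticStructure S ψ L) (hF : ∀ a, ψ a = F a * ψ (g a)) :
    IsAutomaticStructure S (ExpLetter.value ψ F) (expLang g L) := by
  obtain ⟨h_ne, h_reg, h_onto, h_eq, -⟩ := isAutomaticStructure_iff.1 h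
  have reg := isRegular_expLang g h_reg
  refine isAutomaticStructure_iff.2 ⟨?_, reg, ?_, ?_, ?_⟩
  · rintro _ ⟨-, u, hu, hp⟩ rfl
    exact h_ne u hu hp.reduceOption.symm
  · intro s
    obtain ⟨u, hu, e⟩ := h_onto s
    obtain ⟨w, hw, -, hp⟩ := exists_mem_expLang g hu (h_ne u hu) le_rfl
    exact ⟨w, hw, (ev_of_mem_expLang hF hw.1 hp).trans e⟩
  · refine (h_eq.substitution ExpLetter.decode ExpLetter.decode reg reg).congr fun w w' => ?_
    constructor
    · rintro ⟨⟨hw, hw'⟩, e⟩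
      obtain ⟨u, hu, hp⟩ := hw.2
      obtain ⟨u', hu', hp'⟩ := hw'.2
      rw [ev_of_mem_expLang hF hw.1 hp, ev_of_mem_expLang hF hw'.1 hp'] at e
      exact ⟨⟨hw, hw'⟩, u, u', ⟨⟨hu, hu'⟩, e⟩, hp, hp'⟩
    · rintro ⟨⟨hw, hw'⟩, u, u', ⟨-, e⟩, hp, hp'⟩
      rw [← ev_of_mem_expLang hF hw.1 hp, ← ev_of_mem_expLang hF hw'.1 hp'] at e
      exact ⟨⟨hw, hw'⟩, e⟩
  · intro c
    refine ((h.regRel_mul (ExpLetter.value ψ F c)).substitution ExpLetter.decode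
      ExpLetter.decode reg reg).congr fun w w' => ?_
    constructor
    · rintro ⟨⟨hw, hw'⟩, e⟩
      obtain ⟨u, hu, hp⟩ := hw.2
      obtain ⟨u', hu', hp'⟩ := hw'.2
      rw [ev_of_mem_expLang hF hw.1 hp, ev_of_mem_expLang hF hw'.1 hp'] at e
      exact ⟨⟨hw, hw'⟩, u, u', ⟨⟨hu, hu'⟩, e⟩, hp, hp'⟩
    · rintro ⟨⟨hw, hw'⟩, u, u', ⟨-, e⟩, hp, hp'⟩
      rw [← ev_of_mem_expLang hF hw.1 hp, ← ev_of_mem_expLang hF hw'.1 hp'] at e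
      exact ⟨⟨hw, hw'⟩, e⟩

theorem IsAutomaticSemigroup.exists_long_words (h : IsAutomaticSemigroup S)
    (hS : ∀ s : S, ∃ x y, s = x * y) :
    ∃ (A : Type) (_ : Finite A) (ψ : A → S) (L : Language A), IsAutomaticStructure S ψ L ∧
      ∀ s : S, ∃ N, ∀ n ≥ N, ∃ w ∈ L, w.length = n ∧ ev ψ w = s := by
  obtain ⟨A, hA, ψ, L, hL⟩ := h
  obtain ⟨h_ne, -, h_onto, -⟩ := isAutomaticStructure_iff.1 hL
  have split : ∀ a, ∃ r b, ψ a = r * ψ b := by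
    intro a
    obtain ⟨x, y, e⟩ := hS (ψ a)
    obtain ⟨w, hw, hy⟩ := h_onto y
    obtain ⟨w, b, rfl⟩ := (List.eq_nil_or_concat' w).resolve_left (h_ne w hw)
    rw [ev_append, ev_cons, ev_nil, mul_one] at hy
    by_cases h1 : ev ψ w = 1
    · rw [h1, one_mul, WithOne.coe_inj] at hy
      exact ⟨x, b, by rw [e, hy]⟩
    · obtain ⟨t, ht⟩ := WithOne.ne_one_iff_exists.1 h1
      rw [← ht, ← WithOne.coe_mul, WithOne.coe_inj] at hy
      exact ⟨x * t, b, by rw [e, ← hy, mul_assoc]⟩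
  choose F g hF using split
  refine ⟨ExpLetter A, inferInstance, ExpLetter.value ψ F, _, hL.expLang hF, fun s => ?_⟩
  obtain ⟨u, hu, e⟩ := h_onto s
  refine ⟨u.length + 1, fun n hn => ?_⟩
  obtain ⟨w, hw, hl, hp⟩ := exists_mem_expLang g hu (h_ne u hu) hn
  exact ⟨w, hw, hl, (ev_of_mem_expLang hF hw.1 hp).trans e⟩

/-! ### Direct products -/

theorem withOne_prod_ext_iff {x y : WithOne (S × T)} :
    x = y ↔ WithOne.mapMulHom (MulHom.fst S T) x = WithOne.mapMulHom (MulHom.fst S T) y ∧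
      WithOne.mapMulHom (MulHom.snd S T) x = WithOne.mapMulHom (MulHom.snd S T) y := by
  refine ⟨by rintro rfl; exact ⟨rfl, rfl⟩, ?_⟩
  induction x with
  | one =>
    induction y with
    | one => simp
    | coe y => simp
  | coe x =>
    induction y with
    | one => simp
    | coe y =>
      simp only [WithOne.mapMulHom_coe, WithOne.coe_inj]
      rintro ⟨h₁, h₂⟩
      exact Prod.ext h₁ h₂

theorem mapMulHom_ev (f : S →ₙ* T) (ψ : A → S) (w : List A) :
    WithOne.mapMulHom f (ev ψ w) = ev (fun a => f (ψ a)) w := by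
  induction w with
  | nil => simp
  | cons a w ih => simp [ih]

theorem ev_map {B : Type*} (ψ : B → S) (f : A → B) (w : List A) :
    ev ψ (w.map f) = ev (fun a => ψ (f a)) w := by
  simp [ev, Function.comp_def]

theorem IsAutomaticStructure.prod {B : Type*} [Finite A] [Finite B] {ψ : A → S} {φ : B → T}
    {L : Set (List A)} {K : Set (List B)} (hL : IsAutomaticStructure S ψ L)
    (hK : IsAutomaticStructure T φ K)
    (h : ∀ (s : S) (t : T), ∃ u ∈ L, ∃ v ∈ K, u.length = v.length ∧ ev ψ u = s ∧ ev φ v = t) :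
    IsAutomaticStructure (S × T) (Prod.map ψ φ)
      {w | w.map Prod.fst ∈ L ∧ w.map Prod.snd ∈ K} := by
  obtain ⟨hL_ne, hL_reg, -, hL_eq, hL_mul⟩ := isAutomaticStructure_iff.1 hL
  obtain ⟨-, hK_reg, -, hK_eq, hK_mul⟩ := isAutomaticStructure_iff.1 hK
  have e₁ : ∀ w, WithOne.mapMulHom (MulHom.fst S T) (ev (Prod.map ψ φ) w) =
      ev ψ (w.map Prod.fst) := by
    intro w
    rw [mapMulHom_ev, ev_map]
    rfl
  have e₂ : ∀ w, WithOne.mapMulHom (MulHom.snd S T) (ev (Prod.map ψ φ) w) =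
      ev φ (w.map Prod.snd) := by
    intro w
    rw [mapMulHom_ev, ev_map]
    rfl
  refine isAutomaticStructure_iff.2 ⟨?_, ?_, ?_, ?_, ?_⟩
  · rintro _ ⟨h, -⟩ rfl
    exact hL_ne _ h rfl
  · exact IsRegular.inter (IsRegular.preimage _ hL_reg) (IsRegular.preimage _ hK_reg)
  · rintro ⟨s, t⟩
    obtain ⟨u, hu, v, hv, hl, hs, ht⟩ := h s t
    have h₁ : (u.zip v).map Prod.fst = u := List.map_fst_zip hl.le
    have h₂ : (u.zip v).map Prod.snd = v := List.map_snd_zip hl.ge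
    refine ⟨u.zip v, ⟨by rwa [h₁], by rwa [h₂]⟩, ?_⟩
    rw [withOne_prod_ext_iff, e₁, e₂, h₁, h₂, hs, ht]
    exact ⟨rfl, rfl⟩
  · refine ((hL_eq.comap Prod.fst Prod.fst).and (hK_eq.comap Prod.snd Prod.snd)).congr
      fun w w' => ?_
    rw [withOne_prod_ext_iff, e₁, e₁, e₂, e₂]
    simp only [Set.mem_ofPred_eq]
    tauto
  · rintro ⟨a, b⟩
    refine (((hL_mul a).comap Prod.fst Prod.fst).and
      ((hK_mul b).comap Prod.snd Prod.snd)).congr fun w w' => ?_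
    rw [withOne_prod_ext_iff, map_mul, map_mul, e₁, e₁, e₂, e₂, WithOne.mapMulHom_coe,
      WithOne.mapMulHom_coe]
    simp only [Set.mem_ofPred_eq, Prod.map_apply, MulHom.coe_fst, MulHom.coe_snd]
    tauto

theorem SemigroupFG.finite_indecomposable (h : SemigroupFG S) :
    {s : S | ∀ x y, s ≠ x * y}.Finite := by
  obtain ⟨U, hU⟩ := h
  refine U.finite_toSet.subset fun s hs => ?_
  have key : s ∈ (U : Set S) ∨ ∃ x y, s = x * y := by
    have : s ∈ Subsemigroup.closure (U : Set S) := hU ▸ Subsemigroup.mem_top s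
    induction this using Subsemigroup.closure_induction with
    | mem x hx => exact Or.inl hx
    | mul x y _ _ _ _ => exact Or.inr ⟨x, y, rfl⟩
  exact key.resolve_right fun ⟨x, y, e⟩ => hs x y e

theorem SemigroupFG.exists_mul_snd [Infinite S] (h : SemigroupFG (S × T)) (t : T) :
    ∃ x y, t = x * y := by
  by_contra! ht
  refine Set.infinite_of_injective_forall_mem (f := fun s : S => (s, t)) ?_ ?_
    h.finite_indecomposable
  · intro s s' e
    exact congrArg Prod.fst e
  · rintro s x y e
    exact ht x.2 y.2 (congrArg Prod.snd e)

theorem SemigroupFG.exists_mul_fst [Infinite T] (h : SemigroupFG (S × T)) (s : S) :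
    ∃ x y, s = x * y := by
  by_contra! hs
  refine Set.infinite_of_injective_forall_mem (f := fun t : T => (s, t)) ?_ ?_
    h.finite_indecomposable
  · intro t t' e
    exact congrArg Prod.snd e
  · rintro t x y e
    exact hs x.1 y.1 (congrArg Prod.fst e)

theorem IsAutomaticSemigroup.prod_of_infinite [Infinite S] [Infinite T]
    (hS : IsAutomaticSemigroup S) (hT : IsAutomaticSemigroup T) (h : SemigroupFG (S × T)) :
    IsAutomaticSemigroup (S × T) := by
  obtain ⟨A, hA, ψ, L, hL, hL'⟩ := hS.exists_long_words h.exists_mul_fst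
  obtain ⟨B, hB, φ, K, hK, hK'⟩ := hT.exists_long_words h.exists_mul_snd
  refine ⟨A × B, inferInstance, Prod.map ψ φ, _, hL.prod hK fun s t => ?_⟩
  obtain ⟨N, hN⟩ := hL' s
  obtain ⟨M, hM⟩ := hK' t
  obtain ⟨u, hu, hl, hs⟩ := hN (max N M) (le_max_left _ _)
  obtain ⟨v, hv, hl', ht⟩ := hM (max N M) (le_max_right _ _)
  exact ⟨u, hu, v, hv, hl.trans hl'.symm, hs, ht⟩

theorem exists_word_length_eq_of_finite [Finite T] {ψ : A → S} {L : Set (List A)} [Finite A]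
    (hL : IsAutomaticStructure S ψ L) (hT : ∀ t : T, ∃ x y, t = x * y) {B : Type*} {φ : B → T}
    (hφ : Function.Surjective φ) (s : S) (t : T) :
    ∃ u ∈ L, ∃ v ∈ {w : List B | w ≠ []}, u.length = v.length ∧ ev ψ u = s ∧ ev φ v = t := by
  obtain ⟨h_ne, -, h_onto, -⟩ := isAutomaticStructure_iff.1 hL
  obtain ⟨u, hu, e⟩ := h_onto s
  have hpos := List.length_pos_of_ne_nil (h_ne u hu)
  obtain ⟨v, hv, e'⟩ := exists_word_of_length hT hφ (u.length - 1) t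
  refine ⟨u, hu, v, ?_, by omega, e, e'⟩
  rintro rfl
  simp at hv

theorem IsAutomaticSemigroup.prod_finite [Infinite S] [Finite T]
    (hS : IsAutomaticSemigroup S) (h : SemigroupFG (S × T)) :
    IsAutomaticSemigroup (S × T) := by
  obtain ⟨A, hA, ψ, L, hL⟩ := hS
  obtain ⟨n, ⟨e⟩⟩ := Finite.exists_equiv_fin T
  exact ⟨A × Fin n, inferInstance, Prod.map ψ e.symm, _,
    hL.prod (isAutomaticStructure_of_finite e.symm.surjective)
      (exists_word_length_eq_of_finite hL h.exists_mul_snd e.symm.surjective)⟩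

theorem IsAutomaticSemigroup.finite_prod [Finite S] [Infinite T]
    (hT : IsAutomaticSemigroup T) (h : SemigroupFG (S × T)) :
    IsAutomaticSemigroup (S × T) := by
  obtain ⟨B, hB, φ, K, hK⟩ := hT
  obtain ⟨n, ⟨e⟩⟩ := Finite.exists_equiv_fin S
  refine ⟨Fin n × B, inferInstance, Prod.map e.symm φ, _,
    (isAutomaticStructure_of_finite e.symm.surjective).prod hK fun s t => ?_⟩
  obtain ⟨v, hv, u, hu, hl, ht, hs⟩ :=
    exists_word_length_eq_of_finite hK h.exists_mul_fst e.symm.surjective t s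
  exact ⟨u, hu, v, hv, hl.symm, hs, ht⟩

end Eval

end AutoSg

open AutoSg in
/-- The direct product of two automatic semigroups is automatic iff it is
finitely generated. -/
theorem prod_automatic_iff_fg (S T : Type*) [Semigroup S] [Semigroup T]
    (hS : IsAutomaticSemigroup S) (hT : IsAutomaticSemigroup T) :
    IsAutomaticSemigroup (S × T) ↔ SemigroupFG (S × T) := by
  refine ⟨IsAutomaticSemigroup.semigroupFG, fun h => ?_⟩
  rcases finite_or_infinite S with _ | _ <;> rcases finite_or_infinite T with _ | _
  · exact isAutomaticSemigroup_of_finite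
  · exact hT.finite_prod h
  · exact hS.prod_finite h
  · exact hS.prod_of_infinite hT h
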